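/- Let M > 0 and t > 0, and set z := (0,0,t) and y := (0,0,−t) in ℝ³. Then for every x = (x₁,x₂,x₃) ∈ ℝ³ satisfying |x₃| ≤ M(x₁² + x₂²), x ≠ z and x ≠ y, one has the uniform estimate | 1/‖x−z‖ − 1/‖x−y‖ | ≤ 2M. -/

import Mathlib

noncomputable section

open Complex Real

/-- `ℝ³` with the Euclidean norm. -/
abbrev V3 := EuclideanSpace ℝ (Fin 3)

/-- Partial derivative of a complex-valued function on `ℝ³` in the `j`-th coordinate. -/
def pd (j : Fin 3) (f : V3 → ℂ) (x : V3) : ℂ :=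
  fderiv ℝ f x (EuclideanSpace.single j 1)

/-- Fundamental solution `Φ(x,z) = e^{iκ‖x-z‖}/(4π‖x-z‖)` of the 3D Helmholtz equation. -/
def Phi (κ : ℝ) (x z : V3) : ℂ :=
  Complex.exp (Complex.I * κ * ‖x - z‖) / (4 * Real.pi * ‖x - z‖)

/-- The point `(a,b,c)` in `ℝ³`. -/
def mk3 (a b c : ℝ) : V3 := (WithLp.equiv 2 (Fin 3 → ℝ)).symm ![a, b, c]

theorem norm_sub_mk3_sq (x : V3) (s : ℝ) :
    ‖x - mk3 0 0 s‖ ^ 2 = x 0 ^ 2 + x 1 ^ 2 + (x 2 - s) ^ 2 := by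
  simp [EuclideanSpace.norm_sq_eq, Fin.sum_univ_three, mk3]

/-- If `a` and `b` are the distances from a point at height `h` and squared horizontal distance
`ρ` to `(0,0,t)` and `(0,0,-t)`, then `|1/a - 1/b|` is at most `2M` as soon as `|h| ≤ Mρ`. -/
theorem abs_one_div_sub_one_div_le {M t ρ h a b : ℝ} (hM : 0 ≤ M) (ht : 0 < t) (hρ : 0 ≤ ρ)
    (hh : |h| ≤ M * ρ) (ha : 0 < a) (hb : 0 < b)
    (ha2 : a ^ 2 = ρ + (h - t) ^ 2) (hb2 : b ^ 2 = ρ + (h + t) ^ 2) :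
    |1 / a - 1 / b| ≤ 2 * M := by
  have hat : t - h ≤ a := by
    refine le_of_abs_le (abs_le_of_sq_le_sq ?_ ha.le)
    linarith
  have hbt : t + h ≤ b := by
    refine le_of_abs_le (abs_le_of_sq_le_sq ?_ hb.le)
    linarith
  have hab : ρ ≤ a * b := by
    refine le_of_abs_le (abs_le_of_sq_le_sq ?_ (by positivity))
    rw [mul_pow, ha2, hb2]
    nlinarith [mul_nonneg hρ (sq_nonneg (h - t)), mul_nonneg hρ (sq_nonneg (h + t)),
      mul_nonneg (sq_nonneg (h - t)) (sq_nonneg (h + t))]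
  have key : |b - a| * (a + b) = 4 * t * |h| := by
    rw [← abs_of_pos (add_pos ha hb), ← abs_mul, ← abs_of_pos (by positivity : 0 < 4 * t),
      ← abs_mul]
    congr 1
    linarith
  have hdiff : |b - a| ≤ 2 * |h| := by
    nlinarith [mul_le_mul_of_nonneg_left (by linarith : 2 * t ≤ a + b) (abs_nonneg (b - a))]
  rw [div_sub_div _ _ ha.ne' hb.ne', abs_div, abs_of_pos (mul_pos ha hb), one_mul, mul_one,
    div_le_iff₀ (mul_pos ha hb)]
  linarith [mul_le_mul_of_nonneg_left hab hM]

/-- For `M > 0`, `t > 0`, `z := (0,0,t)` and `y := (0,0,−t)`: for every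
`x ∈ ℝ³` with `|x₃| ≤ M(x₁² + x₂²)`, `x ≠ z` and `x ≠ y`, one has
`|1/‖x−z‖ − 1/‖x−y‖| ≤ 2M`. -/
theorem stmt8 (M t : ℝ) (hM : 0 < M) (ht : 0 < t) (x : V3)
    (hx : |x 2| ≤ M * ((x 0) ^ 2 + (x 1) ^ 2))
    (hxz : x ≠ mk3 0 0 t) (hxy : x ≠ mk3 0 0 (-t)) :
    |1 / ‖x - mk3 0 0 t‖ - 1 / ‖x - mk3 0 0 (-t)‖| ≤ 2 * M := by
  refine abs_one_div_sub_one_div_le hM.le ht (by positivity) hx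
    (norm_pos_iff.2 (sub_ne_zero.2 hxz)) (norm_pos_iff.2 (sub_ne_zero.2 hxy))
    (norm_sub_mk3_sq x t) ?_
  rw [norm_sub_mk3_sq, sub_neg_eq_add]
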